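/- Let A = {(i, j) ∈ ℤ × ℤ : 1 ≤ i ≤ j} be partially ordered by (i, j) ≤ (p, q) if and only if i ≤ p and j ≤ q, and for each integer n ≥ 0 let A_n = {(i, j) ∈ A : j ≤ n}. Then there exists exactly one order-preserving function T : A → ℤ_{≥1} such that: (i) for every n ≥ 0, T(1, n+1) = min(ℤ_{≥1} \ T(A_n)) (note that (1, n+1) is the least element of A \ A_n); and (ii) 2·T(i, j) = T(i, i) + T(j, j) for all 1 ≤ i < j. Moreover, this T satisfies T(1,1) = 1 and T(i, i) = 4i − 5 for all i ≥ 2. -/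

import Mathlib

/-- The poset `A = {(i, j) ∈ ℤ × ℤ : 1 ≤ i ≤ j}` of unordered pairs of
positive integers (with the product partial order). -/
def PairPoset : Type := {x : ℤ × ℤ // 1 ≤ x.1 ∧ x.1 ≤ x.2}

/-- The conditions on `T : A → ℤ_{≥1}`:
it takes positive values, is order-preserving, `T(1, n+1)` is the least
positive integer not in `T(A_n)` (where `A_n = {(i,j) ∈ A : j ≤ n}`), and
`2 T(i,j) = T(i,i) + T(j,j)` for `i < j`. -/
def GoodT (T : PairPoset → ℤ) : Prop :=
  (∀ a, 1 ≤ T a) ∧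
  (∀ a b : PairPoset, a.1.1 ≤ b.1.1 → a.1.2 ≤ b.1.2 → T a ≤ T b) ∧
  (∀ n : ℤ, 0 ≤ n → ∀ h : (1 : ℤ) ≤ 1 ∧ (1 : ℤ) ≤ n + 1,
    IsLeast {m : ℤ | 1 ≤ m ∧ ∀ a : PairPoset, a.1.2 ≤ n → T a ≠ m}
      (T ⟨(1, n + 1), h⟩)) ∧
  (∀ a : PairPoset, a.1.1 < a.1.2 →
    2 * T a = T ⟨(a.1.1, a.1.1), a.2.1, le_refl _⟩
            + T ⟨(a.1.2, a.1.2), le_trans a.2.1 a.2.2, le_refl _⟩)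

/-- The explicit solution: `T(1,1) = 1`, `T(1,j) = 2j - 2` for `j ≥ 2`, and
`T(i,j) = 2(i+j) - 5` for `2 ≤ i ≤ j`. -/
def explicitT (a : PairPoset) : ℤ :=
  if a.1.1 = 1 then (if a.1.2 = 1 then 1 else 2 * a.1.2 - 2) else 2 * (a.1.1 + a.1.2) - 5

theorem explicitT_mk (i j : ℤ) (h : 1 ≤ i ∧ i ≤ j) :
    explicitT ⟨(i, j), h⟩ =
      if i = 1 then (if j = 1 then 1 else 2 * j - 2) else 2 * (i + j) - 5 := rfl

theorem explicitT_least (n : ℤ) (hn : 0 ≤ n) (h : (1 : ℤ) ≤ 1 ∧ (1 : ℤ) ≤ n + 1) :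
    IsLeast {m : ℤ | 1 ≤ m ∧ ∀ a : PairPoset, a.1.2 ≤ n → explicitT a ≠ m}
      (explicitT ⟨(1, n + 1), h⟩) := by
  rw [explicitT_mk]
  refine ⟨⟨by split_ifs <;> omega, ?_⟩, ?_⟩
  · rintro ⟨⟨i, j⟩, hi, hij⟩ hj
    rw [explicitT_mk]
    dsimp only at hi hij hj
    split_ifs <;> omega
  · rintro m ⟨hm, hmiss⟩
    by_contra hlt
    have hlt' : m < 2 * n ∧ 1 ≤ n := by
      split_ifs at hlt <;> omega
    obtain ⟨hmn, hn1⟩ := hlt'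
    have hit : ∀ i j : ℤ, 1 ≤ i → i ≤ j → j ≤ n →
        (if i = 1 then (if j = 1 then 1 else 2 * j - 2) else 2 * (i + j) - 5) ≠ m :=
      fun i j hi hij hj => hmiss ⟨(i, j), hi, hij⟩ hj
    rcases Int.even_or_odd' m with ⟨k, rfl | rfl⟩
    · refine hit 1 (k + 1) le_rfl (by omega) (by omega) ?_
      split_ifs <;> omega
    · by_cases hk : k = 0
      · exact hit 1 1 le_rfl le_rfl hn1 (by simp [hk])
      · refine hit ((k + 3) / 2) (k + 3 - (k + 3) / 2) (by omega) (by omega) (by omega) ?_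
        split_ifs <;> omega

theorem goodT_explicitT : GoodT explicitT := by
  refine ⟨?_, ?_, explicitT_least, ?_⟩
  · rintro ⟨⟨i, j⟩, hi, hij⟩
    rw [explicitT_mk]
    dsimp only at hi hij
    split_ifs <;> omega
  · rintro ⟨⟨i, j⟩, hi, hij⟩ ⟨⟨p, q⟩, hp, hpq⟩ hip hjq
    rw [explicitT_mk, explicitT_mk]
    dsimp only at hi hij hp hpq hip hjq
    split_ifs <;> omega
  · rintro ⟨⟨i, j⟩, hi, hij⟩ hlt
    simp only [explicitT_mk]
    dsimp only at hi hij hlt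
    split_ifs <;> omega

theorem GoodT.eq_on_initial {T S : PairPoset → ℤ} (hT : GoodT T) (hS : GoodT S) (n : ℕ) :
    ∀ a : PairPoset, a.1.2 ≤ n → T a = S a := by
  obtain ⟨-, -, hTmin, hTmid⟩ := hT
  obtain ⟨-, -, hSmin, hSmid⟩ := hS
  induction n with
  | zero =>
    rintro ⟨⟨i, j⟩, hi, hij⟩ hj
    dsimp only at hi hij hj
    omega
  | succ n ih =>
    have hfirst : ∀ h : (1 : ℤ) ≤ 1 ∧ (1 : ℤ) ≤ (n : ℤ) + 1,
        T ⟨(1, (n : ℤ) + 1), h⟩ = S ⟨(1, (n : ℤ) + 1), h⟩ := by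
      intro h
      obtain ⟨⟨hT1, hTne⟩, hTle⟩ := hTmin n (by omega) h
      obtain ⟨⟨hS1, hSne⟩, hSle⟩ := hSmin n (by omega) h
      exact le_antisymm (hTle ⟨hS1, fun a ha => ih a ha ▸ hSne a ha⟩)
        (hSle ⟨hT1, fun a ha => ih a ha ▸ hTne a ha⟩)
    have hdiag : ∀ h : (1 : ℤ) ≤ (n : ℤ) + 1 ∧ (n : ℤ) + 1 ≤ (n : ℤ) + 1,
        T ⟨((n : ℤ) + 1, (n : ℤ) + 1), h⟩ = S ⟨((n : ℤ) + 1, (n : ℤ) + 1), h⟩ := by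
      intro h
      have h1 := hfirst ⟨le_rfl, h.1⟩
      rcases Nat.eq_zero_or_pos n with rfl | hn
      · exact h1
      · have hTm := hTmid ⟨(1, (n : ℤ) + 1), le_rfl, h.1⟩ (by dsimp only; omega)
        have hSm := hSmid ⟨(1, (n : ℤ) + 1), le_rfl, h.1⟩ (by dsimp only; omega)
        have h11 := ih ⟨(1, 1), le_rfl, le_rfl⟩ (by dsimp only; omega)
        dsimp only at hTm hSm
        linarith
    rintro ⟨⟨i, j⟩, hi, hij⟩ hj
    dsimp only at hi hij hj
    push_cast at hj
    by_cases hjn : j ≤ n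
    · exact ih _ hjn
    obtain rfl : j = n + 1 := by omega
    rcases eq_or_lt_of_le hij with rfl | hlt
    · exact hdiag _
    · have hTm := hTmid ⟨(i, (n : ℤ) + 1), hi, hij⟩ hlt
      have hSm := hSmid ⟨(i, (n : ℤ) + 1), hi, hij⟩ hlt
      have hii := ih ⟨(i, i), hi, le_rfl⟩ (by dsimp only; omega)
      have hd := hdiag ⟨hi.trans hij, le_rfl⟩
      dsimp only at hTm hSm
      linarith

theorem GoodT.unique {T S : PairPoset → ℤ} (hT : GoodT T) (hS : GoodT S) : T = S :=
  funext fun a => hT.eq_on_initial hS a.1.2.toNat a (Int.self_le_toNat _)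

/-- There is exactly one order-preserving `T : A → ℤ_{≥1}` satisfying
conditions (i) and (ii); moreover it satisfies `T(1,1) = 1` and
`T(i,i) = 4i - 5` for all `i ≥ 2`. -/
theorem stmt16 :
    (∃! T : PairPoset → ℤ, GoodT T) ∧
    ∀ T : PairPoset → ℤ, GoodT T →
      T ⟨(1, 1), le_refl 1, le_refl 1⟩ = 1 ∧
      ∀ i : ℤ, 2 ≤ i → ∀ h : 1 ≤ i ∧ i ≤ i, T ⟨(i, i), h⟩ = 4 * i - 5 := by
  refine ⟨⟨explicitT, goodT_explicitT, fun T hT => hT.unique goodT_explicitT⟩, fun T hT => ?_⟩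
  obtain rfl := hT.unique goodT_explicitT
  refine ⟨rfl, fun i hi h => ?_⟩
  rw [explicitT_mk, if_neg (by omega)]
  ring
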